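/- Let M ≥ 3 be an integer and let c, f_c, d, R_D be positive reals and θ_D a real with cos θ_D > 0. Set ξ_m = −(d²·f_c/(2R_D²))·(m−1)² for m = 1,…,M, and define X = (2π²/c²)·∑_{m=1}^{M}∑_{n=1}^{M} (2(ξ_m − ξ_n))², Y = (4π²·d·f_c·cos θ_D/c²)·∑_{m=1}^{M}∑_{n=1}^{M} 2(ξ_m − ξ_n)(m−n), Z = (8π²·f_c²·d²·cos²θ_D/c²)·∑_{m=1}^{M}∑_{n=1}^{M} (m−n)². Then XZ − Y² > 0 and the range-dimension beamwidth satisfies 2√(M²Z/(XZ − Y²)) = 6√5·c·R_D² / (π·f_c·d²·√((M²−1)(M²−4))). In particular, for fixed M, d, f_c, c, θ_D this beamwidth is proportional to R_D² and hence strictly increasing in the target distance R_D. -/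

import Mathlib

open Real Finset

/-- The effective offset sequence of a phased array (zero frequency offsets):
`ξ_m = −(d²·f_c/(2R²))·(m−1)²`, as a function of the target distance `R`. -/
noncomputable def xiPA (d f_c R : ℝ) (m : ℕ) : ℝ :=
  -(d ^ 2 * f_c / (2 * R ^ 2)) * ((m : ℝ) - 1) ^ 2

/-- Coefficient `X` of the half-power boundary quadratic form of Lemma 1. -/
noncomputable def coefX (c : ℝ) (M : ℕ) (ξ : ℕ → ℝ) : ℝ :=
  (2 * π ^ 2 / c ^ 2) * ∑ m ∈ Icc 1 M, ∑ n ∈ Icc 1 M, (2 * (ξ m - ξ n)) ^ 2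

/-- Coefficient `Y` of the half-power boundary quadratic form of Lemma 1. -/
noncomputable def coefY (c d f_c θ_D : ℝ) (M : ℕ) (ξ : ℕ → ℝ) : ℝ :=
  (4 * π ^ 2 * d * f_c * Real.cos θ_D / c ^ 2) *
    ∑ m ∈ Icc 1 M, ∑ n ∈ Icc 1 M, 2 * (ξ m - ξ n) * ((m : ℝ) - (n : ℝ))

/-- Coefficient `Z` of the half-power boundary quadratic form of Lemma 1. -/
noncomputable def coefZ (c d f_c θ_D : ℝ) (M : ℕ) : ℝ :=
  (8 * π ^ 2 * f_c ^ 2 * d ^ 2 * Real.cos θ_D ^ 2 / c ^ 2) *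
    ∑ m ∈ Icc 1 M, ∑ n ∈ Icc 1 M, ((m : ℝ) - (n : ℝ)) ^ 2

/-- The range-dimension main-lobe beamwidth `Δ_R = 2√(M²Z/(XZ − Y²))` of Theorem 1
for a phased array aimed at distance `R`. -/
noncomputable def rangeBeamwidth (c d f_c θ_D : ℝ) (M : ℕ) (R : ℝ) : ℝ :=
  2 * Real.sqrt ((M : ℝ) ^ 2 * coefZ c d f_c θ_D M /
    (coefX c M (xiPA d f_c R) * coefZ c d f_c θ_D M -
      coefY c d f_c θ_D M (xiPA d f_c R) ^ 2))

theorem sum_Icc_sum_Icc_sub_mul_sub (M : ℕ) (p q : ℕ → ℝ) :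
    ∑ m ∈ Icc 1 M, ∑ n ∈ Icc 1 M, (p m - p n) * (q m - q n) =
      2 * (M * ∑ m ∈ Icc 1 M, p m * q m - (∑ m ∈ Icc 1 M, p m) * ∑ m ∈ Icc 1 M, q m) := by
  have h : ∀ m n, (p m - p n) * (q m - q n) =
      p m * q m - p m * q n - p n * q m + p n * q n := fun m n => by ring
  simp only [h, sum_add_distrib, sum_sub_distrib, ← mul_sum, ← sum_mul, sum_const,
    Nat.card_Icc, nsmul_eq_mul, Nat.add_sub_cancel]
  simp only [mul_left_comm _ (M : ℝ), ← mul_sum]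
  ring

theorem sum_Icc_sub_one_pow_one (M : ℕ) :
    ∑ m ∈ Icc 1 M, ((m : ℝ) - 1) = (M : ℝ) * (M - 1) / 2 := by
  induction M with
  | zero => simp
  | succ k ih => rw [sum_Icc_succ_top (by omega), ih]; push_cast; ring

theorem sum_Icc_sub_one_pow_two (M : ℕ) :
    ∑ m ∈ Icc 1 M, ((m : ℝ) - 1) ^ 2 = (M : ℝ) * (M - 1) * (2 * M - 1) / 6 := by
  induction M with
  | zero => simp
  | succ k ih => rw [sum_Icc_succ_top (by omega), ih]; push_cast; ring

theorem sum_Icc_sub_one_pow_three (M : ℕ) :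
    ∑ m ∈ Icc 1 M, ((m : ℝ) - 1) ^ 3 = ((M : ℝ) * (M - 1) / 2) ^ 2 := by
  induction M with
  | zero => simp
  | succ k ih => rw [sum_Icc_succ_top (by omega), ih]; push_cast; ring

theorem sum_Icc_sub_one_pow_four (M : ℕ) :
    ∑ m ∈ Icc 1 M, ((m : ℝ) - 1) ^ 4 =
      (M : ℝ) * (M - 1) * (2 * M - 1) * (3 * M ^ 2 - 3 * M - 1) / 30 := by
  induction M with
  | zero => simp
  | succ k ih => rw [sum_Icc_succ_top (by omega), ih]; push_cast; ring

theorem coefZ_eq (c d f_c θ_D : ℝ) (M : ℕ) :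
    coefZ c d f_c θ_D M =
      (8 * π ^ 2 * f_c ^ 2 * d ^ 2 * Real.cos θ_D ^ 2 / c ^ 2) *
        ((M : ℝ) ^ 2 * ((M : ℝ) ^ 2 - 1) / 6) := by
  have h : ∑ m ∈ Icc 1 M, ∑ n ∈ Icc 1 M, ((m : ℝ) - (n : ℝ)) ^ 2 =
      (M : ℝ) ^ 2 * ((M : ℝ) ^ 2 - 1) / 6 := by
    have key := sum_Icc_sum_Icc_sub_mul_sub M (fun m => (m : ℝ) - 1) (fun m => (m : ℝ) - 1)
    simp only [sub_sub_sub_cancel_right, ← pow_two] at key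
    rw [key, sum_Icc_sub_one_pow_one, sum_Icc_sub_one_pow_two]
    ring
  rw [coefZ, h]

theorem coefY_xiPA (c d f_c θ_D R : ℝ) (M : ℕ) :
    coefY c d f_c θ_D M (xiPA d f_c R) =
      (4 * π ^ 2 * d * f_c * Real.cos θ_D / c ^ 2) *
        (-(d ^ 2 * f_c / R ^ 2) * (((M : ℝ) - 1) * (M ^ 2 * (M ^ 2 - 1)) / 6)) := by
  have h : ∑ m ∈ Icc 1 M, ∑ n ∈ Icc 1 M,
      2 * (xiPA d f_c R m - xiPA d f_c R n) * ((m : ℝ) - (n : ℝ)) =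
      -(d ^ 2 * f_c / R ^ 2) * (((M : ℝ) - 1) * (M ^ 2 * (M ^ 2 - 1)) / 6) := by
    have key := sum_Icc_sum_Icc_sub_mul_sub M (fun m => ((m : ℝ) - 1) ^ 2)
      (fun m => (m : ℝ) - 1)
    simp only [← pow_succ, Nat.reduceAdd] at key
    rw [sum_Icc_sub_one_pow_one, sum_Icc_sub_one_pow_two, sum_Icc_sub_one_pow_three] at key
    have e : ∀ m n : ℕ, 2 * (xiPA d f_c R m - xiPA d f_c R n) * ((m : ℝ) - (n : ℝ)) =
        -(d ^ 2 * f_c / R ^ 2) *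
          ((((m : ℝ) - 1) ^ 2 - ((n : ℝ) - 1) ^ 2) * (((m : ℝ) - 1) - ((n : ℝ) - 1))) := by
      intro m n
      simp only [xiPA]
      ring
    simp only [e, ← mul_sum]
    rw [key]
    ring
  rw [coefY, h]

theorem coefX_xiPA (c d f_c R : ℝ) (M : ℕ) :
    coefX c M (xiPA d f_c R) =
      (2 * π ^ 2 / c ^ 2) * ((d ^ 2 * f_c / R ^ 2) ^ 2 *
        ((M : ℝ) ^ 2 * (M ^ 2 - 1) * ((M - 1) ^ 2 / 6 + (M ^ 2 - 4) / 90))) := by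
  have h : ∑ m ∈ Icc 1 M, ∑ n ∈ Icc 1 M, (2 * (xiPA d f_c R m - xiPA d f_c R n)) ^ 2 =
      (d ^ 2 * f_c / R ^ 2) ^ 2 *
        ((M : ℝ) ^ 2 * (M ^ 2 - 1) * ((M - 1) ^ 2 / 6 + (M ^ 2 - 4) / 90)) := by
    have key := sum_Icc_sum_Icc_sub_mul_sub M (fun m => ((m : ℝ) - 1) ^ 2)
      (fun m => ((m : ℝ) - 1) ^ 2)
    simp only [← pow_add, Nat.reduceAdd] at key
    rw [sum_Icc_sub_one_pow_two, sum_Icc_sub_one_pow_four] at key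
    have e : ∀ m n : ℕ, (2 * (xiPA d f_c R m - xiPA d f_c R n)) ^ 2 =
        (d ^ 2 * f_c / R ^ 2) ^ 2 *
          ((((m : ℝ) - 1) ^ 2 - ((n : ℝ) - 1) ^ 2) *
            (((m : ℝ) - 1) ^ 2 - ((n : ℝ) - 1) ^ 2)) := by
      intro m n
      simp only [xiPA]
      ring
    simp only [e, ← mul_sum]
    rw [key]
    ring
  rw [coefX, h]

/-- The discriminant `XZ − Y²` in closed form. -/
theorem coefX_mul_coefZ_sub_coefY_sq (c d f_c θ_D R : ℝ) (M : ℕ) :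
    coefX c M (xiPA d f_c R) * coefZ c d f_c θ_D M -
        coefY c d f_c θ_D M (xiPA d f_c R) ^ 2 =
      coefZ c d f_c θ_D M * ((2 * π ^ 2 / c ^ 2) * (d ^ 2 * f_c / R ^ 2) ^ 2 *
        ((M : ℝ) ^ 2 * ((M ^ 2 - 1) * (M ^ 2 - 4)) / 90)) := by
  rw [coefX_xiPA, coefY_xiPA, coefZ_eq]
  ring

theorem coefZ_pos {M : ℕ} (hM : 2 ≤ M) {c f_c d θ_D : ℝ} (hc : 0 < c) (hf : 0 < f_c)
    (hd : 0 < d) (hθ : 0 < Real.cos θ_D) : 0 < coefZ c d f_c θ_D M := by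
  have h : (2 : ℝ) ≤ M := by exact_mod_cast hM
  have h1 : (0 : ℝ) < (M : ℝ) ^ 2 - 1 := by nlinarith
  rw [coefZ_eq]
  positivity

theorem sq_sub_one_mul_sq_sub_four_pos {x : ℝ} (hx : 2 < x) :
    0 < (x ^ 2 - 1) * (x ^ 2 - 4) :=
  mul_pos (by nlinarith) (by nlinarith)

theorem rangeBeamwidth_eq {M : ℕ} (hM : 3 ≤ M) {c f_c d R θ_D : ℝ} (hc : 0 < c)
    (hf : 0 < f_c) (hd : 0 < d) (hR : 0 < R) (hθ : 0 < Real.cos θ_D) :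
    rangeBeamwidth c d f_c θ_D M R =
      6 * Real.sqrt 5 * c * R ^ 2 /
        (π * f_c * d ^ 2 * Real.sqrt (((M : ℝ) ^ 2 - 1) * ((M : ℝ) ^ 2 - 4))) := by
  have hM' : (2 : ℝ) < M := by exact_mod_cast hM
  have hZ := coefZ_pos (show 2 ≤ M by omega) hc hf hd hθ
  have hP := sq_sub_one_mul_sq_sub_four_pos hM'
  rw [rangeBeamwidth, coefX_mul_coefZ_sub_coefY_sq]
  generalize coefZ c d f_c θ_D M = Z at hZ ⊢
  generalize ((M : ℝ) ^ 2 - 1) * ((M : ℝ) ^ 2 - 4) = P at hP ⊢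
  have hsq : (M : ℝ) ^ 2 * Z / (Z * ((2 * π ^ 2 / c ^ 2) * (d ^ 2 * f_c / R ^ 2) ^ 2 *
      ((M : ℝ) ^ 2 * P / 90))) =
      (3 * Real.sqrt 5 * c * R ^ 2 / (π * f_c * d ^ 2 * Real.sqrt P)) ^ 2 := by
    have hM0 : (M : ℝ) ≠ 0 := by positivity
    simp only [div_pow, mul_pow, Real.sq_sqrt hP.le, Real.sq_sqrt (show (0 : ℝ) ≤ 5 by norm_num)]
    field_simp
    norm_num
  rw [hsq, Real.sqrt_sq (by positivity)]
  ring

/-- Corollary 1 and Remark 2 (range-dimension beamwidth): for a phased array with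
`M ≥ 3` antennas, `XZ − Y² > 0`, the range-dimension beamwidth `2√(M²Z/(XZ − Y²))`
equals `6√5·c·R_D² / (π·f_c·d²·√((M²−1)(M²−4)))`, and (being proportional to `R_D²`)
the beamwidth is strictly increasing in the target distance `R_D`. -/
theorem phased_array_range_beamwidth (M : ℕ) (hM : 3 ≤ M) (c f_c d R_D θ_D : ℝ)
    (hc : 0 < c) (hf : 0 < f_c) (hd : 0 < d) (hR : 0 < R_D)
    (hθ : 0 < Real.cos θ_D) :
    0 < coefX c M (xiPA d f_c R_D) * coefZ c d f_c θ_D M -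
        coefY c d f_c θ_D M (xiPA d f_c R_D) ^ 2 ∧
    rangeBeamwidth c d f_c θ_D M R_D =
      6 * Real.sqrt 5 * c * R_D ^ 2 /
        (π * f_c * d ^ 2 * Real.sqrt (((M : ℝ) ^ 2 - 1) * ((M : ℝ) ^ 2 - 4))) ∧
    ∀ R₁ R₂ : ℝ, 0 < R₁ → R₁ < R₂ →
      rangeBeamwidth c d f_c θ_D M R₁ < rangeBeamwidth c d f_c θ_D M R₂ := by
  have hM' : (2 : ℝ) < M := by exact_mod_cast hM
  have hP := sq_sub_one_mul_sq_sub_four_pos hM'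
  refine ⟨?_, rangeBeamwidth_eq hM hc hf hd hR hθ, fun R₁ R₂ h₁ h₁₂ => ?_⟩
  · have hZ := coefZ_pos (show 2 ≤ M by omega) hc hf hd hθ
    rw [coefX_mul_coefZ_sub_coefY_sq]
    positivity
  · rw [rangeBeamwidth_eq hM hc hf hd h₁ hθ, rangeBeamwidth_eq hM hc hf hd (h₁.trans h₁₂) hθ]
    gcongr
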